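/- For every λ > 0, ∫_{-∞}^0 2φ(x)Φ(λx) dx = (1/π)·arctan(1/λ). Equivalently, if λ = δ/√(1 − δ²) for δ ∈ (0, 1), then the probability that a skew normal SN(λ) random variable is negative equals arccos(δ)/π. -/

import Mathlib

open MeasureTheory ProbabilityTheory Real Filter
open scoped ENNReal NNReal Topology

noncomputable section

/-- Density of the standard normal distribution. -/
def stdPDF (x : ℝ) : ℝ := Real.exp (-x ^ 2 / 2) / Real.sqrt (2 * Real.pi)

/-- Cumulative distribution function of the standard normal distribution. -/
def stdCDF (x : ℝ) : ℝ := ∫ y in Set.Iic x, stdPDF y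

/-- Density of the skew normal distribution with parameter `l`. -/
def skewPDF (l x : ℝ) : ℝ := 2 * stdPDF x * stdCDF (l * x)

/-- Cumulative distribution function of the skew normal distribution `SN(l)`. -/
def skewCDF (l x : ℝ) : ℝ := ∫ y in Set.Iic x, skewPDF l y

/-- The skew normal distribution `SN(l)`. -/
def skewNormal (l : ℝ) : Measure ℝ :=
  (volume : Measure ℝ).withDensity fun x => ENNReal.ofReal (skewPDF l x)

lemma stdPDF_nonneg (x : ℝ) : 0 ≤ stdPDF x := by unfold stdPDF; positivity

lemma stdPDF_neg (x : ℝ) : stdPDF (-x) = stdPDF x := by simp [stdPDF]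

lemma continuous_stdPDF : Continuous stdPDF := by unfold stdPDF; fun_prop

lemma integrable_stdPDF : Integrable stdPDF := by
  convert (integrable_exp_neg_mul_sq (b := 1 / 2) (by norm_num)).div_const √(2 * π) using 2 with x
  rw [stdPDF]
  ring_nf

lemma stdCDF_nonneg (x : ℝ) : 0 ≤ stdCDF x := integral_nonneg stdPDF_nonneg

lemma skewPDF_nonneg (l x : ℝ) : 0 ≤ skewPDF l x :=
  mul_nonneg (mul_nonneg zero_le_two (stdPDF_nonneg x)) (stdCDF_nonneg _)

lemma continuous_stdCDF : Continuous stdCDF := by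
  have h : stdCDF = fun x => stdCDF 0 + ∫ y in (0 : ℝ)..x, stdPDF y := by
    ext x
    rw [← intervalIntegral.integral_Iic_sub_Iic integrable_stdPDF.integrableOn
      integrable_stdPDF.integrableOn]
    simp [stdCDF]
  rw [h]
  exact continuous_const.add
    (intervalIntegral.continuous_primitive (fun _ _ => integrable_stdPDF.intervalIntegrable) 0)

lemma continuous_skewPDF (l : ℝ) : Continuous (skewPDF l) := by
  have h₁ := continuous_stdPDF
  have h₂ := continuous_stdCDF
  unfold skewPDF
  fun_prop

lemma stdCDF_mul_of_neg (l : ℝ) {x : ℝ} (hx : x < 0) :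
    stdCDF (l * x) = ∫ t in Set.Ioi l, -x * stdPDF (t * -x) := by
  have hx' : 0 < -x := neg_pos.2 hx
  rw [integral_const_mul, integral_comp_mul_right_Ioi _ _ hx', smul_eq_mul,
    mul_inv_cancel_left₀ hx'.ne', mul_neg, ← integral_comp_neg_Iic]
  simp only [stdPDF_neg, stdCDF]

lemma two_mul_stdPDF_mul_stdPDF (x t : ℝ) :
    2 * stdPDF x * (-x * stdPDF (t * -x)) =
      -x * rexp (-((1 + t ^ 2) / 2) * x ^ 2) / π := by
  have h : √(2 * π) * √(2 * π) = 2 * π := mul_self_sqrt (by positivity)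
  have he : rexp (-((1 + t ^ 2) / 2) * x ^ 2) =
      rexp (-x ^ 2 / 2) * rexp (-(t * -x) ^ 2 / 2) := by
    rw [← Real.exp_add]
    ring_nf
  rw [he, stdPDF, stdPDF]
  calc _ = 2 * -x * (rexp (-x ^ 2 / 2) * rexp (-(t * -x) ^ 2 / 2)) / (√(2 * π) * √(2 * π)) := by
        field_simp
    _ = _ := by rw [h]; field_simp

lemma ofReal_skewPDF_of_neg (l : ℝ) {x : ℝ} (hx : x < 0) :
    ENNReal.ofReal (skewPDF l x) =
      ∫⁻ t in Set.Ioi l, ENNReal.ofReal (-x * rexp (-((1 + t ^ 2) / 2) * x ^ 2) / π) := by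
  simp only [← two_mul_stdPDF_mul_stdPDF]
  rw [skewPDF, stdCDF_mul_of_neg l hx, ← integral_const_mul,
    ofReal_integral_eq_lintegral_ofReal]
  · exact (((integrable_stdPDF.comp_mul_right' (neg_ne_zero.2 hx.ne)).const_mul _).const_mul
      _).integrableOn
  · exact ae_of_all _ fun t => mul_nonneg (mul_nonneg zero_le_two (stdPDF_nonneg x))
      (mul_nonneg (neg_pos.2 hx).le (stdPDF_nonneg _))

lemma integrable_neg_mul_exp_neg_mul_sq {b : ℝ} (hb : 0 < b) :
    Integrable fun x : ℝ => -x * rexp (-b * x ^ 2) := by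
  refine (integrable_mul_exp_neg_mul_sq hb).neg.congr (ae_of_all _ fun x => ?_)
  simp

lemma integral_Iic_neg_mul_exp_neg_mul_sq {b : ℝ} (hb : 0 < b) :
    ∫ x in Set.Iic (0 : ℝ), -x * rexp (-b * x ^ 2) = (2 * b)⁻¹ := by
  have hderiv : ∀ x ∈ Set.Iic (0 : ℝ),
      HasDerivAt (fun x => (2 * b)⁻¹ * rexp (-b * x ^ 2)) (-x * rexp (-b * x ^ 2)) x := by
    intro x _
    refine (((hasDerivAt_pow 2 x).const_mul (-b)).exp.const_mul (2 * b)⁻¹).congr_deriv ?_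
    simp only [Nat.cast_ofNat, Nat.add_one_sub_one, pow_one]
    field_simp
  have hlim : Tendsto (fun x : ℝ => (2 * b)⁻¹ * rexp (-b * x ^ 2)) atBot (𝓝 0) := by
    have hsq : Tendsto (fun x : ℝ => x ^ 2) atBot atTop := by
      simpa only [pow_two, id] using tendsto_id.atBot_mul_atBot₀ tendsto_id
    simpa using (tendsto_exp_atBot.comp (hsq.const_mul_atTop_of_neg (neg_lt_zero.2 hb))).const_mul
      (2 * b)⁻¹
  simpa using integral_Iic_of_hasDerivAt_of_tendsto' hderiv
    (integrable_neg_mul_exp_neg_mul_sq hb).integrableOn hlim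

lemma lintegral_Iio_neg_mul_exp (t : ℝ) :
    ∫⁻ x in Set.Iio (0 : ℝ), ENNReal.ofReal (-x * rexp (-((1 + t ^ 2) / 2) * x ^ 2) / π) =
      ENNReal.ofReal ((1 + t ^ 2)⁻¹ / π) := by
  have hb : 0 < (1 + t ^ 2) / 2 := by positivity
  rw [← ofReal_integral_eq_lintegral_ofReal
      ((integrable_neg_mul_exp_neg_mul_sq hb).div_const π).integrableOn,
    ← integral_Iic_eq_integral_Iio, integral_div, integral_Iic_neg_mul_exp_neg_mul_sq hb,
    mul_div_cancel₀ _ two_ne_zero]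
  filter_upwards [ae_restrict_mem measurableSet_Iio] with x hx
  have : 0 < -x := neg_pos.2 hx
  simp only [Pi.zero_apply]
  positivity

lemma lintegral_Iio_skewPDF {l : ℝ} (hl : 0 < l) :
    ∫⁻ x in Set.Iio (0 : ℝ), ENNReal.ofReal (skewPDF l x) =
      ENNReal.ofReal (1 / π * arctan (1 / l)) := by
  rw [setLIntegral_congr_fun measurableSet_Iio fun x hx => ofReal_skewPDF_of_neg l hx,
    lintegral_lintegral_swap (Measurable.aemeasurable (by fun_prop))]
  simp only [lintegral_Iio_neg_mul_exp]
  rw [← ofReal_integral_eq_lintegral_ofReal (integrable_inv_one_add_sq.div_const π).integrableOn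
    (ae_of_all _ fun t => by simp only [Pi.zero_apply]; positivity), integral_div,
    integral_Ioi_inv_one_add_sq, one_div l, arctan_inv_of_pos hl, one_div_mul_eq_div]

/-- for `λ > 0`, `∫_{-∞}^0 2φ(x)Φ(λx) dx = (1/π)·arctan(1/λ)`;
equivalently, if `λ = δ/√(1 − δ²)` with `δ ∈ (0,1)`, the probability that a skew normal
`SN(λ)` random variable is negative equals `arccos(δ)/π`. -/
theorem stmt12 (lam : ℝ) (hlam : 0 < lam) :
    (∫ x in Set.Iic (0 : ℝ), skewPDF lam x = (1 / Real.pi) * Real.arctan (1 / lam)) ∧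
    (∀ δ : ℝ, 0 < δ → δ < 1 → lam = δ / Real.sqrt (1 - δ ^ 2) →
      skewNormal lam (Set.Iio 0) = ENNReal.ofReal (Real.arccos δ / Real.pi)) := by
  refine ⟨?_, fun δ h₀ h₁ hδ => ?_⟩
  · rw [integral_Iic_eq_integral_Iio, integral_eq_lintegral_of_nonneg_ae
      (ae_of_all _ (skewPDF_nonneg lam)) (continuous_skewPDF lam).aestronglyMeasurable,
      lintegral_Iio_skewPDF hlam, ENNReal.toReal_ofReal]
    have := arctan_pos.2 (one_div_pos.2 hlam)
    positivity
  · rw [skewNormal, withDensity_apply _ measurableSet_Iio, lintegral_Iio_skewPDF hlam,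
      arccos_eq_arctan h₀, hδ, one_div_div, one_div_mul_eq_div]
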